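/- Let G be a finite simple graph, v a vertex of degree ρ with neighbours u_1, …, u_ρ, and let x be a vector with A(G)x = 0. Write a = x(v) and b_i = x(u_i). Define a vector x' on the vertices of the Fowler construction F(G,v) by: x'(w) = x(w) for every vertex w of G other than v, x'(v) = −(ρ−1)a, x'(p_i) = a and x'(q_i) = b_i for each i. Then A(F(G,v))x' = 0. Moreover, if all entries of x are nonzero and ρ ≥ 2, then all entries of x' are nonzero. -/

import Mathlib

open Matrix

/-- Adjacency matrix of a finite simple graph over `ℚ`. -/
noncomputable def adjMat {V : Type*} [Fintype V] [DecidableEq V] (G : SimpleGraph V) :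
    Matrix V V ℚ :=
  letI := Classical.decRel G.Adj
  G.adjMatrix ℚ

/-- A core graph: some kernel eigenvector of the adjacency matrix has all entries nonzero. -/
def IsCoreGraph {V : Type*} [Fintype V] [DecidableEq V] (G : SimpleGraph V) : Prop :=
  ∃ x : V → ℚ, (adjMat G).mulVec x = 0 ∧ ∀ w, x w ≠ 0

/-- The nullity of a graph: dimension of the kernel of its adjacency matrix. -/
noncomputable def nullity {V : Type*} [Fintype V] [DecidableEq V] (G : SimpleGraph V) : ℕ :=
  Module.finrank ℚ (LinearMap.ker (adjMat G).mulVecLin)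

/-- A nut graph: a core graph of nullity one. -/
def IsNutGraph {V : Type*} [Fintype V] [DecidableEq V] (G : SimpleGraph V) : Prop :=
  IsCoreGraph G ∧ nullity G = 1

/-- A graph is `ρ`-regular if every vertex has degree `ρ`. -/
def IsRegularGraph {V : Type*} (G : SimpleGraph V) (ρ : ℕ) : Prop :=
  ∀ w, Nat.card (G.neighborSet w) = ρ

/-- The Fowler construction `F(G,v)`. -/
def Fowler {V : Type*} (G : SimpleGraph V) (v : V) :
    SimpleGraph (V ⊕ (↥(G.neighborSet v) ⊕ ↥(G.neighborSet v))) :=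
  SimpleGraph.fromRel (fun a b =>
    match a, b with
    | Sum.inl w₁, Sum.inl w₂ => G.Adj w₁ w₂ ∧ w₁ ≠ v ∧ w₂ ≠ v
    | Sum.inl w, Sum.inr (Sum.inl u) => w = (u : V)
    | Sum.inl w, Sum.inr (Sum.inr _) => w = v
    | Sum.inr (Sum.inl u), Sum.inr (Sum.inr u') => (u : V) ≠ (u' : V)
    | _, _ => False)


theorem adjMat_mulVec_apply {V : Type*} [Fintype V] [DecidableEq V] (G : SimpleGraph V)
    [DecidableRel G.Adj] (x : V → ℚ) (w : V) :
    (adjMat G).mulVec x w = ∑ u, if G.Adj w u then x u else 0 := by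
  simp only [adjMat, mulVec, dotProduct, SimpleGraph.adjMatrix_apply, ite_mul, one_mul, zero_mul]

namespace Fowler

variable {V : Type*} (G : SimpleGraph V) (v : V)

theorem adj_inl_inl (a b : V) :
    (Fowler G v).Adj (Sum.inl a) (Sum.inl b) ↔ G.Adj a b ∧ a ≠ v ∧ b ≠ v := by
  simp only [Fowler, SimpleGraph.fromRel_adj, ne_eq, Sum.inl.injEq, G.adj_comm b a]
  refine ⟨by tauto, fun h => ⟨h.1.ne, Or.inl h⟩⟩

theorem adj_inl_p (a : V) (u : G.neighborSet v) :
    (Fowler G v).Adj (Sum.inl a) (Sum.inr (Sum.inl u)) ↔ a = u := by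
  simp [Fowler, SimpleGraph.fromRel_adj]

theorem adj_inl_q (a : V) (u : G.neighborSet v) :
    (Fowler G v).Adj (Sum.inl a) (Sum.inr (Sum.inr u)) ↔ a = v := by
  simp [Fowler, SimpleGraph.fromRel_adj]

theorem adj_p_q (u u' : G.neighborSet v) :
    (Fowler G v).Adj (Sum.inr (Sum.inl u)) (Sum.inr (Sum.inr u')) ↔ u ≠ u' := by
  simp [Fowler, SimpleGraph.fromRel_adj, Subtype.ext_iff]

theorem not_adj_p_p (u u' : G.neighborSet v) :
    ¬ (Fowler G v).Adj (Sum.inr (Sum.inl u)) (Sum.inr (Sum.inl u')) := by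
  simp [Fowler, SimpleGraph.fromRel_adj]

theorem not_adj_q_q (u u' : G.neighborSet v) :
    ¬ (Fowler G v).Adj (Sum.inr (Sum.inr u)) (Sum.inr (Sum.inr u')) := by
  simp [Fowler, SimpleGraph.fromRel_adj]

theorem adj_p_inl (a : V) (u : G.neighborSet v) :
    (Fowler G v).Adj (Sum.inr (Sum.inl u)) (Sum.inl a) ↔ a = u := by
  rw [SimpleGraph.adj_comm, adj_inl_p]

theorem adj_q_inl (a : V) (u : G.neighborSet v) :
    (Fowler G v).Adj (Sum.inr (Sum.inr u)) (Sum.inl a) ↔ a = v := by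
  rw [SimpleGraph.adj_comm, adj_inl_q]

theorem adj_q_p (u u' : G.neighborSet v) :
    (Fowler G v).Adj (Sum.inr (Sum.inr u)) (Sum.inr (Sum.inl u')) ↔ u' ≠ u := by
  rw [SimpleGraph.adj_comm, adj_p_q]

end Fowler

theorem sum_neighborSet {V : Type*} [Fintype V] (G : SimpleGraph V)
    [DecidableRel G.Adj] (v : V) (f : V → ℚ) :
    ∑ u : G.neighborSet v, f u = ∑ u, if G.Adj v u then f u else 0 := by
  rw [← Finset.sum_filter]
  exact (Finset.sum_subtype _ (by simp) f).symm

/-- Lifting a kernel vector of `G` to the Fowler construction: set `x' = x` on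
`V(G) \\ {v}`, `x'(v) = -(ρ-1)·x(v)`, `x'(pᵢ) = x(v)`, `x'(qᵢ) = x(uᵢ)`.  Then
`A(F(G,v)) x' = 0`; moreover if `x` has no zero entries and `ρ ≥ 2`, neither has `x'`. -/
theorem fowler_kernel_vector_lift {V : Type*} [Fintype V] [DecidableEq V]
    (G : SimpleGraph V) [DecidableRel G.Adj] (v : V) (rho : ℕ)
    (hdeg : Nat.card (G.neighborSet v) = rho)
    (x : V → ℚ) (hx : (adjMat G).mulVec x = 0) :
    (adjMat (Fowler G v)).mulVec
        (fun a => match a with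
          | Sum.inl w => if w = v then -((rho : ℚ) - 1) * x v else x w
          | Sum.inr (Sum.inl _) => x v
          | Sum.inr (Sum.inr u) => x (u : V)) = 0 ∧
      ((∀ w, x w ≠ 0) → 2 ≤ rho →
        ∀ a : V ⊕ (↥(G.neighborSet v) ⊕ ↥(G.neighborSet v)),
          (fun a => match a with
            | Sum.inl w => if w = v then -((rho : ℚ) - 1) * x v else x w
            | Sum.inr (Sum.inl _) => x v
            | Sum.inr (Sum.inr u) => x (u : V)) a ≠ 0) := by
  classical
  have hG : ∀ w, (∑ u, if G.Adj w u then x u else 0) = 0 := fun w => by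
    rw [← adjMat_mulVec_apply, hx, Pi.zero_apply]
  have hv : ∑ u : G.neighborSet v, x u = 0 := by rw [sum_neighborSet, hG]
  have hcard : (Fintype.card (G.neighborSet v) : ℚ) = rho := by
    rw [← hdeg, Nat.card_eq_fintype_card]
  refine ⟨?_, fun hne hrho a => ?_⟩
  · funext a
    rw [adjMat_mulVec_apply, Fintype.sum_sum_type, Fintype.sum_sum_type, Pi.zero_apply]
    rcases a with w | u | u
    · simp only [Fowler.adj_inl_inl, Fowler.adj_inl_p, Fowler.adj_inl_q]
      by_cases hw : w = v
      · subst hw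
        have hp : ∀ u : G.neighborSet w, w ≠ u := fun u => u.2.ne
        simp [hv, hp]
      · have hp : (∑ u : G.neighborSet v, if w = u then x v else 0) =
            if G.Adj w v then x v else 0 := by
          rw [sum_neighborSet G v fun u => if w = u then x v else 0]
          rw [Finset.sum_eq_single w (by simp +contextual [eq_comm]) (by simp), if_pos rfl,
            if_congr (G.adj_comm w v) rfl rfl]
        have hs : (∑ u, if G.Adj w u ∧ w ≠ v ∧ u ≠ v then
            (if u = v then -((rho : ℚ) - 1) * x v else x u) else 0) +
            (if G.Adj w v then x v else 0) = ∑ u, if G.Adj w u then x u else 0 := by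
          rw [← Finset.sum_erase_add _ _ (Finset.mem_univ v),
            ← Finset.sum_erase_add _ (fun u => if G.Adj w u then x u else 0) (Finset.mem_univ v)]
          simp only [ne_eq, not_true_eq_false, and_false, if_false, add_zero]
          congr 1
          refine Finset.sum_congr rfl fun u hu => ?_
          simp [Finset.ne_of_mem_erase hu, hw]
        simp only [if_neg hw]
        rw [hp, Finset.sum_const_zero, add_zero]
        exact hs.trans (hG w)
    · have huv : (u : V) ≠ v := u.2.ne'
      have hq := Finset.sum_erase_add _ (fun u : G.neighborSet v => x u) (Finset.mem_univ u)
      rw [hv] at hq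
      simp only [Fowler.adj_p_inl, Fowler.not_adj_p_p, Fowler.adj_p_q]
      simp only [Finset.sum_ite_eq', Finset.mem_univ, if_true, if_false, huv,
        Finset.sum_const_zero, zero_add, ← Finset.sum_filter, Finset.filter_ne]
      simp
      linarith
    · simp only [Fowler.adj_q_inl, Fowler.not_adj_q_q, Fowler.adj_q_p, if_false,
        Finset.sum_const_zero, add_zero, Finset.sum_ite_eq', Finset.mem_univ, if_true]
      rw [← Finset.sum_filter, Finset.filter_ne', Finset.sum_const, nsmul_eq_mul,
        Finset.cast_card_erase_of_mem (Finset.mem_univ u), Finset.card_univ, hcard]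
      ring
  · have hrho' : (2 : ℚ) ≤ rho := by exact_mod_cast hrho
    rcases a with w | u | u
    · dsimp only
      split_ifs
      · exact mul_ne_zero (by linarith) (hne v)
      · exact hne w
    · exact hne v
    · exact hne u
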